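/- Let (A,Ω) be a relative fractal drum in ℝ^N such that D := dim_B(A,Ω) exists, D < N, and M_*^D(A,Ω) > 0. Then ζ_{A,Ω}(σ) = ∫_Ω dist(x,A)^{σ−N} dx tends to +∞ as σ → D⁺ through real values σ > D. -/

import Mathlib

open MeasureTheory Filter Complex Set Metric Topology Asymptotics
open scoped ENNReal NNReal

noncomputable section

/-- The open `t`-neighborhood `A_t = {x : dist(x,A) < t}` of a set `A ⊆ ℝ^N`. -/
def nbhd (N : ℕ) (A : Set (EuclideanSpace ℝ (Fin N))) (t : ℝ) :
    Set (EuclideanSpace ℝ (Fin N)) :=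
  {x | Metric.infDist x A < t}

/-- The volume `|A_t ∩ Ω|` of the `t`-neighborhood of `A` relative to `Ω`. -/
def tubeVol (N : ℕ) (A Ω : Set (EuclideanSpace ℝ (Fin N))) (t : ℝ) : ℝ :=
  (volume (nbhd N A t ∩ Ω)).toReal

/-- The upper `r`-dimensional Minkowski content of the relative fractal drum `(A,Ω)`. -/
def upperContent (N : ℕ) (A Ω : Set (EuclideanSpace ℝ (Fin N))) (r : ℝ) : ℝ≥0∞ :=
  Filter.limsup
    (fun t : ℝ => volume (nbhd N A t ∩ Ω) / ENNReal.ofReal (t ^ ((N : ℝ) - r)))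
    (nhdsWithin 0 (Set.Ioi 0))

/-- The lower `r`-dimensional Minkowski content of the relative fractal drum `(A,Ω)`. -/
def lowerContent (N : ℕ) (A Ω : Set (EuclideanSpace ℝ (Fin N))) (r : ℝ) : ℝ≥0∞ :=
  Filter.liminf
    (fun t : ℝ => volume (nbhd N A t ∩ Ω) / ENNReal.ofReal (t ^ ((N : ℝ) - r)))
    (nhdsWithin 0 (Set.Ioi 0))

/-- `D` is the (finite) upper box (Minkowski) dimension of `(A,Ω)`:
the greatest lower bound of `{r : M^{*r}(A,Ω) = 0}`. -/
def IsUpperMinkDim (N : ℕ) (A Ω : Set (EuclideanSpace ℝ (Fin N))) (D : ℝ) : Prop :=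
  IsGLB {r : ℝ | upperContent N A Ω r = 0} D

/-- `D` is the (finite) lower box (Minkowski) dimension of `(A,Ω)`. -/
def IsLowerMinkDim (N : ℕ) (A Ω : Set (EuclideanSpace ℝ (Fin N))) (D : ℝ) : Prop :=
  IsGLB {r : ℝ | lowerContent N A Ω r = 0} D

/-- The box (Minkowski) dimension of `(A,Ω)` exists and equals `D`. -/
def IsMinkDim (N : ℕ) (A Ω : Set (EuclideanSpace ℝ (Fin N))) (D : ℝ) : Prop :=
  IsUpperMinkDim N A Ω D ∧ IsLowerMinkDim N A Ω D

/-- `(A,Ω)` is a relative fractal drum in `ℝ^N`. -/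
def IsRFD (N : ℕ) (A Ω : Set (EuclideanSpace ℝ (Fin N))) : Prop :=
  A.Nonempty ∧ MeasurableSet Ω ∧ volume Ω < ⊤ ∧ ∃ δ₀ > (0 : ℝ), Ω ⊆ nbhd N A δ₀

/-- The relative distance zeta function `ζ_{A,Ω}(s) = ∫_Ω d(x,A)^{s-N} dx`. -/
def distZeta (N : ℕ) (A Ω : Set (EuclideanSpace ℝ (Fin N))) (s : ℂ) : ℂ :=
  ∫ x in Ω, (Metric.infDist x A : ℂ) ^ (s - (N : ℂ))

/-- The relative distance zeta function with parameter `δ`: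
`ζ_{A,Ω}(s;δ) = ∫_{A_δ ∩ Ω} d(x,A)^{s-N} dx`. -/
def distZetaD (N : ℕ) (A Ω : Set (EuclideanSpace ℝ (Fin N))) (δ : ℝ) (s : ℂ) : ℂ :=
  ∫ x in nbhd N A δ ∩ Ω, (Metric.infDist x A : ℂ) ^ (s - (N : ℂ))

/-- The relative tube zeta function `ζ̃_{A,Ω}(s;δ) = ∫_0^δ t^{s-N-1}|A_t ∩ Ω| dt`. -/
def tubeZeta (N : ℕ) (A Ω : Set (EuclideanSpace ℝ (Fin N))) (δ : ℝ) (s : ℂ) : ℂ :=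
  ∫ t in Set.Ioc (0 : ℝ) δ, (t : ℂ) ^ (s - (N : ℂ) - 1) * ((tubeVol N A Ω t : ℝ) : ℂ)

/-- The Mellin zeta function `ζ^𝔐_{A,Ω}(s) = ∫_0^∞ t^{s-N-1}|A_t ∩ Ω| dt`. -/
def mellinZeta (N : ℕ) (A Ω : Set (EuclideanSpace ℝ (Fin N))) (s : ℂ) : ℂ :=
  ∫ t in Set.Ioi (0 : ℝ), (t : ℂ) ^ (s - (N : ℂ) - 1) * ((tubeVol N A Ω t : ℝ) : ℂ)

/-- `(A,Ω)` is Minkowski measurable with dimension `D` and Minkowski content `M`. -/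
def MinkMeasurable (N : ℕ) (A Ω : Set (EuclideanSpace ℝ (Fin N))) (D M : ℝ) : Prop :=
  0 < M ∧
    Tendsto (fun t : ℝ => tubeVol N A Ω t / t ^ ((N : ℝ) - D))
      (nhdsWithin 0 (Set.Ioi 0)) (nhds M)

/-- `ω` is a pole of `F` (the norm of `F` blows up at `ω`). -/
def IsPoleAt (F : ℂ → ℂ) (ω : ℂ) : Prop :=
  Tendsto (fun s => ‖F s‖) (nhdsWithin ω {ω}ᶜ) atTop

/-- The languidity conditions **L1**–**L2** for `F` with screen `S`, exponent `κ`,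
constants `c`, `C` and two-sided sequence `T`. -/
def LanguidWith (F : ℂ → ℂ) (S : ℝ → ℝ) (κ c C : ℝ) (T : ℤ → ℝ) : Prop :=
  0 < C ∧
  (∀ n : ℤ, 1 ≤ n → T (-n) < 0 ∧ 0 < T n) ∧
  Tendsto (fun n : ℕ => T (n : ℤ)) atTop atTop ∧
  Tendsto (fun n : ℕ => T (-(n : ℤ))) atTop atBot ∧
  (∀ n : ℤ, ∀ σ : ℝ, S (T n) < σ → σ < c →
    ‖F ((σ : ℂ) + (T n : ℝ) * Complex.I)‖ ≤ C * (|T n| + 1) ^ κ) ∧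
  (∀ τ : ℝ, 1 ≤ |τ| → ‖F ((S τ : ℂ) + (τ : ℝ) * Complex.I)‖ ≤ C * |τ| ^ κ)

/-- `S` is a screen (for upper box dimension `D`): a Lipschitz function bounded below,
with `sup S ≤ D`. -/
def IsScreen (S : ℝ → ℝ) (D : ℝ) : Prop :=
  (∃ K : NNReal, LipschitzWith K S) ∧ BddBelow (Set.range S) ∧ ∀ τ : ℝ, S τ ≤ D

/-- The window associated with the screen `S`. -/
def window (S : ℝ → ℝ) : Set ℂ :=
  {s : ℂ | S s.im ≤ s.re}


section RpowLintegral

variable {X : Type*} [MeasurableSpace X] {μ : Measure X} {d : X → ℝ}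

theorem measure_zero_of_eventually_le_rpow {q : ℝ} (hq : 0 < q)
    (h : ∀ᶠ t in 𝓝[>] (0 : ℝ), μ {x | d x < t} ≤ ENNReal.ofReal (t ^ q)) :
    Tendsto (fun t => μ {x | d x < t}) (𝓝[>] (0 : ℝ)) (𝓝 0) ∧ μ {x | d x ≤ 0} = 0 := by
  have hlim : Tendsto (fun t : ℝ => ENNReal.ofReal (t ^ q)) (𝓝[>] (0 : ℝ)) (𝓝 0) := by
    have h0 : ContinuousAt (fun t : ℝ => ENNReal.ofReal (t ^ q)) 0 :=
      ENNReal.continuous_ofReal.continuousAt.comp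
        (Real.continuousAt_rpow_const 0 q (Or.inr hq.le))
    simpa [ContinuousAt, Real.zero_rpow hq.ne'] using h0.tendsto.mono_left nhdsWithin_le_nhds
  have hV : Tendsto (fun t => μ {x | d x < t}) (𝓝[>] (0 : ℝ)) (𝓝 0) :=
    tendsto_of_tendsto_of_tendsto_of_le_of_le' tendsto_const_nhds hlim
      (Eventually.of_forall fun _ => zero_le) h
  refine ⟨hV, le_antisymm (ge_of_tendsto hV ?_) zero_le⟩
  filter_upwards [self_mem_nhdsWithin] with t (ht : 0 < t)
  exact measure_mono fun x (hx : d x ≤ 0) => hx.trans_lt ht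

/-- A weak-type bound on the sublevel sets of `d` with exponent `q` makes `d ^ (-p)` integrable
for every `0 < p < q`. -/
theorem lintegral_rpow_neg_lt_top [IsFiniteMeasure μ] (hd : Measurable d) (hd0 : ∀ x, 0 ≤ d x)
    {p q : ℝ} (hp : 0 < p) (hpq : p < q)
    (h : ∀ᶠ t in 𝓝[>] (0 : ℝ), μ {x | d x < t} ≤ ENNReal.ofReal (t ^ q)) :
    ∫⁻ x, ENNReal.ofReal (d x ^ (-p)) ∂μ < ⊤ := by
  obtain ⟨t₀, ht₀ : 0 < t₀, h₀⟩ := mem_nhdsGT_iff_exists_Ioo_subset.1 h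
  set u₀ : ℝ := t₀ ^ (-p)
  have hu₀ : 0 < u₀ := Real.rpow_pos_of_pos ht₀ _
  rw [lintegral_eq_lintegral_meas_lt μ (Eventually.of_forall fun x => Real.rpow_nonneg (hd0 x) _)
    (hd.pow_const _).aemeasurable, ← Ioc_union_Ioi_eq_Ioi hu₀.le]
  refine (lintegral_union_le _ _ _).trans_lt (ENNReal.add_lt_top.2 ⟨?_, ?_⟩)
  · calc ∫⁻ u in Ioc 0 u₀, μ {x | u < d x ^ (-p)} ≤ ∫⁻ _ in Ioc 0 u₀, μ univ :=
          lintegral_mono fun u => measure_mono (subset_univ _)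
      _ < ⊤ := by
          rw [setLIntegral_const]
          exact ENNReal.mul_lt_top (measure_lt_top _ _) measure_Ioc_lt_top
  · have hint : IntegrableOn (fun u : ℝ => u ^ (-(q / p))) (Ioi u₀) :=
      integrableOn_Ioi_rpow_of_lt (by rw [neg_lt_neg_iff, one_lt_div hp]; exact hpq) hu₀
    refine lt_of_le_of_lt (setLIntegral_mono' measurableSet_Ioi fun u (hu : u₀ < u) => ?_)
      hint.lintegral_lt_top
    have hu0 : 0 < u := hu₀.trans hu
    have hinv : (u ^ (-p⁻¹)) ^ (-p) = u := by
      rw [← Real.rpow_mul hu0.le, neg_mul_neg, inv_mul_cancel₀ hp.ne', Real.rpow_one]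
    have hpos : 0 < u ^ (-p⁻¹) := Real.rpow_pos_of_pos hu0 _
    have hlt : u ^ (-p⁻¹) < t₀ := by
      rw [← hinv] at hu
      exact (Real.rpow_lt_rpow_iff_of_neg ht₀ hpos (neg_lt_zero.2 hp)).1 hu
    calc μ {x | u < d x ^ (-p)} ≤ μ {x | d x < u ^ (-p⁻¹)} := by
          refine measure_mono fun x (hx : u < d x ^ (-p)) => ?_
          have hdx : 0 < d x := by
            refine (hd0 x).lt_of_ne fun h0 => ?_
            rw [← h0, Real.zero_rpow (neg_ne_zero.2 hp.ne')] at hx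
            exact hu0.not_gt hx
          rw [← hinv] at hx
          exact (Real.rpow_lt_rpow_iff_of_neg hpos hdx (neg_lt_zero.2 hp)).1 hx
      _ ≤ ENNReal.ofReal ((u ^ (-p⁻¹)) ^ q) := h₀ ⟨hpos, hlt⟩
      _ = ENNReal.ofReal (u ^ (-(q / p))) := by
          rw [← Real.rpow_mul hu0.le]
          congr 2
          field_simp

/-- If the sublevel sets of `d` have measure at least `c * t ^ p` with `c > 0`, then `d ^ (-p)` is
not integrable. -/
theorem lintegral_rpow_neg_eq_top {p : ℝ} (hp : 0 < p) (hd : Measurable d)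
    (h0 : μ {x | d x ≤ 0} = 0) (hV : Tendsto (fun t => μ {x | d x < t}) (𝓝[>] (0 : ℝ)) (𝓝 0))
    {c : ℝ≥0∞} (hc : 0 < c)
    (h : ∀ᶠ t in 𝓝[>] (0 : ℝ), c * ENNReal.ofReal (t ^ p) ≤ μ {x | d x < t}) :
    ∫⁻ x, ENNReal.ofReal (d x ^ (-p)) ∂μ = ⊤ := by
  by_contra hfin
  have hlim := tendsto_setLIntegral_zero hfin (s := fun t => {x | d x < t}) hV
  refine hc.not_ge (ge_of_tendsto hlim ?_)
  filter_upwards [h, self_mem_nhdsWithin] with t ht (ht0 : 0 < t)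
  have hpos : ∀ᵐ x ∂μ, 0 < d x := by simpa [ae_iff] using h0
  calc c = ENNReal.ofReal (t ^ (-p)) * (c * ENNReal.ofReal (t ^ p)) := by
        rw [mul_left_comm, ← ENNReal.ofReal_mul (Real.rpow_nonneg ht0.le _),
          ← Real.rpow_add ht0, neg_add_cancel, Real.rpow_zero, ENNReal.ofReal_one, mul_one]
    _ ≤ ENNReal.ofReal (t ^ (-p)) * μ {x | d x < t} := by gcongr
    _ = ∫⁻ _ in {x | d x < t}, ENNReal.ofReal (t ^ (-p)) ∂μ := (setLIntegral_const _ _).symm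
    _ ≤ ∫⁻ x in {x | d x < t}, ENNReal.ofReal (d x ^ (-p)) ∂μ := by
        refine setLIntegral_mono_ae (hd.pow_const _).ennreal_ofReal.aemeasurable ?_
        filter_upwards [hpos] with x hx hxt
        exact ENNReal.ofReal_le_ofReal
          (Real.rpow_le_rpow_of_nonpos hx (le_of_lt hxt) (neg_nonpos.2 hp.le))

/-- Non-integrability of `d ^ a` for `a < 0` forces the integrals of `d ^ b` to blow up as
`b → a`. -/
theorem tendsto_lintegral_rpow_top (hd : Measurable d) (hd0 : ∀ x, 0 ≤ d x) {a : ℝ} (ha : a < 0)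
    (h : ∫⁻ x, ENNReal.ofReal (d x ^ a) ∂μ = ⊤) :
    Tendsto (fun b : ℝ => ∫⁻ x, ENNReal.ofReal (d x ^ b) ∂μ) (𝓝 a) (𝓝 ⊤) := by
  refine tendsto_of_seq_tendsto fun u hu => ?_
  have hpt : ∀ x, Tendsto (fun n => ENNReal.ofReal (d x ^ u n)) atTop
      (𝓝 (ENNReal.ofReal (d x ^ a))) := fun x => by
    refine (ENNReal.continuous_ofReal.tendsto _).comp ?_
    rcases (hd0 x).eq_or_lt with h0 | h0
    · rw [← h0, Real.zero_rpow ha.ne]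
      refine tendsto_const_nhds.congr' ?_
      filter_upwards [hu.eventually_lt_const ha] with n hn
      rw [Real.zero_rpow hn.ne]
    · exact (Real.continuousAt_const_rpow h0.ne').tendsto.comp hu
  refine tendsto_of_le_liminf_of_limsup_le ?_ le_top
  calc (⊤ : ℝ≥0∞) = ∫⁻ x, liminf (fun n => ENNReal.ofReal (d x ^ u n)) atTop ∂μ := by
        rw [← h]
        exact lintegral_congr fun x => (hpt x).liminf_eq.symm
    _ ≤ _ := lintegral_liminf_le fun n => (hd.pow_const _).ennreal_ofReal

end RpowLintegral

theorem exists_eventually_volume_le_rpow {N : ℕ} {A Ω : Set (EuclideanSpace ℝ (Fin N))} {D s : ℝ}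
    (hD : IsUpperMinkDim N A Ω D) (hs : D < s) :
    ∃ r < s, ∀ᶠ t in 𝓝[>] (0 : ℝ),
      volume (nbhd N A t ∩ Ω) ≤ ENNReal.ofReal (t ^ ((N : ℝ) - r)) := by
  obtain ⟨r, hr, -, hrs⟩ := hD.exists_between hs
  refine ⟨r, hrs, ?_⟩
  have hlt : upperContent N A Ω r < 1 := by
    rw [show upperContent N A Ω r = 0 from hr]; exact one_pos
  filter_upwards [eventually_lt_of_limsup_lt hlt, self_mem_nhdsWithin] with t ht (ht0 : 0 < t)
  have hpos := ENNReal.ofReal_pos.2 (Real.rpow_pos_of_pos ht0 ((N : ℝ) - r))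
  simpa using (ENNReal.div_le_iff hpos.ne' ENNReal.ofReal_ne_top).1 ht.le

/-- Let `(A,Ω)` be a relative fractal drum in `ℝ^N` such that `D := dim_B(A,Ω)` exists,
`D < N`, and `M_*^D(A,Ω) > 0`.  Then `ζ_{A,Ω}(σ) = ∫_Ω dist(x,A)^{σ−N} dx` tends to `+∞`
as `σ → D⁺` through real values `σ > D`. -/
theorem statement1
    (N : ℕ) (A Ω : Set (EuclideanSpace ℝ (Fin N))) (D : ℝ)
    (hRFD : IsRFD N A Ω) (hD : IsMinkDim N A Ω D) (hDN : D < N)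
    (hM : 0 < lowerContent N A Ω D) :
    Tendsto (fun σ : ℝ => ∫ x in Ω, Metric.infDist x A ^ (σ - (N : ℝ)))
      (nhdsWithin D (Set.Ioi D)) atTop := by
  obtain ⟨-, -, hfin, -⟩ := hRFD
  have : IsFiniteMeasure (volume.restrict Ω) := ⟨by simpa using hfin⟩
  have hd : Measurable fun x : EuclideanSpace ℝ (Fin N) => infDist x A :=
    (continuous_infDist_pt A).measurable
  have hd0 : ∀ x : EuclideanSpace ℝ (Fin N), 0 ≤ infDist x A := fun _ => infDist_nonneg
  have hV : ∀ t, volume.restrict Ω {x | infDist x A < t} = volume (nbhd N A t ∩ Ω) := fun t =>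
    Measure.restrict_apply (measurableSet_lt hd measurable_const)
  have hlow : ∃ c > 0, ∀ᶠ t in 𝓝[>] (0 : ℝ),
      c * ENNReal.ofReal (t ^ ((N : ℝ) - D)) ≤ volume.restrict Ω {x | infDist x A < t} := by
    obtain ⟨c, hc, hcM⟩ := exists_between hM
    refine ⟨c, hc, ?_⟩
    filter_upwards [eventually_lt_of_lt_liminf hcM] with t ht
    rw [hV]
    exact ENNReal.mul_le_of_le_div ht.le
  obtain ⟨c, hc, hlow⟩ := hlow
  obtain ⟨r, hr, hup⟩ := exists_eventually_volume_le_rpow hD.1 hDN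
  simp only [← hV] at hup
  obtain ⟨hV0, hzero⟩ := measure_zero_of_eventually_le_rpow (sub_pos.2 hr) hup
  have htop := lintegral_rpow_neg_eq_top (sub_pos.2 hDN) hd hzero hV0 hc hlow
  rw [neg_sub] at htop
  have hlim := tendsto_lintegral_rpow_top hd hd0 (sub_neg.2 hDN) htop
  have hshift : Tendsto (fun σ : ℝ => σ - (N : ℝ)) (𝓝[>] D) (𝓝 (D - N)) :=
    ((continuous_sub_right (N : ℝ)).tendsto D).mono_left nhdsWithin_le_nhds
  refine tendsto_atTop.2 fun b => ?_
  filter_upwards [(hlim.comp hshift).eventually_const_lt (ENNReal.ofReal_lt_top (r := b)),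
    Ioo_mem_nhdsGT hDN] with σ hb ⟨hDσ, hσN⟩
  rw [integral_eq_lintegral_of_nonneg_ae
    (Eventually.of_forall fun x => Real.rpow_nonneg (hd0 x) _)
    (hd.pow_const _).aestronglyMeasurable]
  obtain ⟨s, hs, hups⟩ := exists_eventually_volume_le_rpow hD.1 hDσ
  simp only [← hV] at hups
  have hlt := lintegral_rpow_neg_lt_top hd hd0 (sub_pos.2 hσN)
    (sub_lt_sub_left hs (N : ℝ)) hups
  rw [neg_sub] at hlt
  exact (ENNReal.ofReal_le_iff_le_toReal hlt.ne).1 hb.le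

end
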